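/- Let a signed graph be structurally balanced with gauge σ, let f : ℝ → ℝ be even (f (-t) = f t for all t), and let φ be an unsigned automorphism. Then the signed disagreement nonlinear flow F is invariant under the induced signed automorphism: for every x : Fin n → ℝ and every vertex i, F (Φ' x) i = F x (φ i). (Theorem 6, even case.) -/

import Mathlib

/-- In a balanced signed graph, the sign of an edge is the product of the gauge values of its
endpoints. -/
theorem Real.sign_eq_gauge_mul_gauge {s t w : ℝ} (hs : s = 1 ∨ s = -1) (ht : t = 1 ∨ t = -1)
    (hbal : s * t * w ≥ 0) (hw : w ≠ 0) : Real.sign w = s * t := by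
  rcases lt_or_gt_of_ne hw with h | h
  · rw [Real.sign_of_neg h]
    rcases hs with rfl | rfl <;> rcases ht with rfl | rfl <;> linarith
  · rw [Real.sign_of_pos h]
    rcases hs with rfl | rfl <;> rcases ht with rfl | rfl <;> linarith

/-- Theorem 6, even case: on a structurally balanced graph, the signed disagreement
nonlinear flow with even `f` is invariant under the signed automorphism induced by an
unsigned automorphism. -/
theorem disagreement_flow_signed_automorphism_invariant_even
    (n : ℕ) (a : Fin n → Fin n → ℝ)
    (hsym : ∀ i j, a i j = a j i) (hdiag : ∀ i, a i i = 0)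
    (σ : Fin n → ℝ) (hgauge : ∀ i, σ i = 1 ∨ σ i = -1)
    (hbal : ∀ i j, σ i * σ j * a i j ≥ 0)
    (f : ℝ → ℝ) (heven : ∀ t, f (-t) = f t)
    (φ : Equiv.Perm (Fin n))
    (haut : ∀ i j, |a (φ i) (φ j)| = |a i j|)
    (F : (Fin n → ℝ) → (Fin n → ℝ))
    (hF : ∀ x i, F x i =
      -f (∑ j ∈ Finset.univ.filter (fun j => a i j ≠ 0),
        (x i - Real.sign (a i j) * x j)))
    (x : Fin n → ℝ) (i : Fin n) :
    F (fun k => σ k * σ (φ k) * x (φ k)) i = F x (φ i) := by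
  have hsum : ∑ j ∈ Finset.univ.filter (fun j => a i j ≠ 0),
        (σ i * σ (φ i) * x (φ i) - Real.sign (a i j) * (σ j * σ (φ j) * x (φ j))) =
      σ i * σ (φ i) * ∑ j ∈ Finset.univ.filter (fun j => a (φ i) j ≠ 0),
        (x (φ i) - Real.sign (a (φ i) j) * x j) := by
    have hsq : ∀ k, σ k * σ k = 1 := fun k => by rcases hgauge k with h | h <;> simp [h]
    have hne : ∀ j, a i j ≠ 0 ↔ a (φ i) (φ j) ≠ 0 := fun j => by
      rw [← abs_ne_zero, ← haut, abs_ne_zero]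
    rw [Finset.mul_sum]
    refine Finset.sum_equiv φ (fun j => by simpa using hne j) fun j hj => ?_
    have hij : a i j ≠ 0 := by simpa using hj
    rw [Real.sign_eq_gauge_mul_gauge (hgauge i) (hgauge j) (hbal i j) hij,
      Real.sign_eq_gauge_mul_gauge (hgauge (φ i)) (hgauge (φ j)) (hbal (φ i) (φ j))
        ((hne j).1 hij)]
    linear_combination σ i * σ (φ j) * x (φ j) * (hsq (φ i) - hsq j)
  rw [hF, hF, hsum]
  generalize ∑ j ∈ Finset.univ.filter (fun j => a (φ i) j ≠ 0),
    (x (φ i) - Real.sign (a (φ i) j) * x j) = t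
  rcases hgauge i with h | h <;> rcases hgauge (φ i) with h' | h' <;> simp [h, h', heven]
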